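/- arXiv:2604.17150 — 3 statements merged into one kernel-verified Lean document; each statement's English description precedes it below -/
import Mathlib

section
/- For every real a > 0 and every real ω̃ > 0 with a² ω̃² < 1, the improper complex integral L₀(ω̃) = ∫₀^∞ e^{i ω̃ λ} · λ^{-a² ω̃²} dλ, understood as the limit of ∫₀^T as T → ∞, converges and equals i · e^{-i π a² ω̃² / 2} · ω̃^{a² ω̃² − 1} · Γ(1 − a² ω̃²). -/
open Real Filter

lemma norm_integral_cexp_mul_rpow_le {s : ℝ} (hs : 0 < s) {r : ℂ} (hr : r ≠ 0) (hre : 0 ≤ r.re)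
    {A B : ℝ} (hA : 0 < A) (hAB : A ≤ B) :
    ‖∫ t in A..B, Complex.exp (-r * (t : ℂ)) * ((t ^ (-s) : ℝ) : ℂ)‖ ≤ 2 * A ^ (-s) / ‖r‖ := by
  have hpos : ∀ t ∈ Set.uIcc A B, 0 < t := fun t ht => by
    rw [Set.uIcc_of_le hAB] at ht
    exact hA.trans_le ht.1
  have hr' : 0 < ‖r‖ := norm_pos_iff.mpr hr
  have hexp : ∀ t : ℝ, 0 < t → ‖Complex.exp (-r * (t : ℂ))‖ ≤ 1 := fun t ht => by
    rw [Complex.norm_exp, Real.exp_le_one_iff]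
    simp only [Complex.mul_re, Complex.neg_re, Complex.ofReal_re, Complex.ofReal_im, mul_zero,
      sub_zero]
    nlinarith [mul_nonneg hre ht.le]
  have hv : ∀ t ∈ Set.uIcc A B, HasDerivAt (fun t : ℝ => -Complex.exp (-r * (t : ℂ)) / r)
      (Complex.exp (-r * (t : ℂ))) t := fun t _ => by
    refine (((((hasDerivAt_id t).ofReal_comp).const_mul (-r)).cexp.neg).div_const r).congr_deriv ?_
    simp only [id, Complex.ofReal_one]
    field_simp
  have hu' : ∀ t ∈ Set.uIcc A B, HasDerivAt (fun t : ℝ => t ^ (-s)) (-s * t ^ (-s - 1)) t :=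
    fun t ht => Real.hasDerivAt_rpow_const (Or.inl (hpos t ht).ne')
  have hu : ∀ t ∈ Set.uIcc A B, HasDerivAt (fun t : ℝ => ((t ^ (-s) : ℝ) : ℂ))
      ((-s * t ^ (-s - 1) : ℝ) : ℂ) t := fun t ht => (hu' t ht).ofReal_comp
  have hcont : ContinuousOn (fun t : ℝ => -s * t ^ (-s - 1)) (Set.uIcc A B) :=
    continuousOn_const.mul (continuousOn_id.rpow_const fun t ht => Or.inl (hpos t ht).ne')
  have hparts := intervalIntegral.integral_mul_deriv_eq_deriv_mul hu hv
    (Complex.continuous_ofReal.comp_continuousOn hcont).intervalIntegrable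
    (Continuous.intervalIntegrable (by fun_prop) A B)
  have hFTC := intervalIntegral.integral_eq_sub_of_hasDerivAt hu' hcont.intervalIntegrable
  have hrem : ‖∫ t in A..B, ((-s * t ^ (-s - 1) : ℝ) : ℂ) * (-Complex.exp (-r * (t : ℂ)) / r)‖
      ≤ (A ^ (-s) - B ^ (-s)) / ‖r‖ := by
    calc _ ≤ ∫ t in A..B, -(-s * t ^ (-s - 1)) / ‖r‖ := by
          refine intervalIntegral.norm_integral_le_of_norm_le hAB ?_
            (hcont.neg.div_const _).intervalIntegrable
          refine MeasureTheory.ae_of_all _ fun t ht => ?_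
          have ht0 : 0 < t := hA.trans ht.1
          have hp : 0 < t ^ (-s - 1) := Real.rpow_pos_of_pos ht0 _
          rw [norm_mul, norm_div, norm_neg, Complex.norm_real, Real.norm_eq_abs,
            abs_of_nonpos (by nlinarith), ← mul_div_assoc]
          gcongr
          exact mul_le_of_le_one_right (by nlinarith) (hexp t ht0)
      _ = _ := by
          rw [intervalIntegral.integral_div, intervalIntegral.integral_neg, hFTC]
          ring
  have hbd : ∀ t : ℝ, 0 < t →
      ‖((t ^ (-s) : ℝ) : ℂ) * (-Complex.exp (-r * (t : ℂ)) / r)‖ ≤ t ^ (-s) / ‖r‖ := fun t ht => by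
    have hp : 0 < t ^ (-s) := Real.rpow_pos_of_pos ht _
    rw [norm_mul, norm_div, norm_neg, Complex.norm_real, Real.norm_of_nonneg hp.le, div_eq_mul_inv,
      div_eq_mul_inv]
    have := mul_le_mul_of_nonneg_right (hexp t ht) (inv_nonneg.mpr hr'.le)
    rw [one_mul] at this
    gcongr
  simp_rw [mul_comm (Complex.exp _)]
  rw [hparts]
  refine (norm_sub_le _ _).trans ((add_le_add ((norm_sub_le _ _).trans
    (add_le_add (hbd B (hA.trans_le hAB)) (hbd A hA))) hrem).trans (le_of_eq ?_))
  ring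

lemma integrableOn_cexp_mul_rpow {s : ℝ} (hs : s < 1) {r : ℂ} (hr : 0 < r.re) :
    MeasureTheory.IntegrableOn
      (fun t : ℝ => Complex.exp (-r * (t : ℂ)) * ((t ^ (-s) : ℝ) : ℂ)) (Set.Ioi 0) := by
  have h := integrableOn_rpow_mul_exp_neg_mul_rpow (p := 1) (s := -s) (by linarith) one_pos hr
  refine MeasureTheory.Integrable.mono' h ?_ ?_
  · refine Measurable.aestronglyMeasurable ?_
    fun_prop
  · refine (MeasureTheory.ae_restrict_iff' measurableSet_Ioi).mpr
      (MeasureTheory.ae_of_all _ fun t ht => ?_)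
    rw [norm_mul, Complex.norm_exp, Complex.norm_real,
      Real.norm_of_nonneg (Real.rpow_nonneg (le_of_lt ht) _), mul_comm]
    simp

lemma differentiableOn_integral_cexp_mul_rpow {s : ℝ} (hs : s < 1) :
    DifferentiableOn ℂ (fun r : ℂ => ∫ t in Set.Ioi (0 : ℝ),
      Complex.exp (-r * (t : ℂ)) * ((t ^ (-s) : ℝ) : ℂ)) {r : ℂ | 0 < r.re} := by
  have hmeas : Measurable fun t : ℝ => (t ^ (-s)).toNNReal := by fun_prop
  set μ : MeasureTheory.Measure ℝ := (MeasureTheory.volume.restrict (Set.Ioi (0 : ℝ))).withDensity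
    (fun t => (((t ^ (-s)).toNNReal : NNReal) : ENNReal)) with hμ
  have heq : (fun r : ℂ => ∫ t in Set.Ioi (0 : ℝ),
      Complex.exp (-r * (t : ℂ)) * ((t ^ (-s) : ℝ) : ℂ)) =
      fun r => ProbabilityTheory.complexMGF id μ (-r) := by
    ext r
    rw [ProbabilityTheory.complexMGF, hμ, integral_withDensity_eq_integral_smul hmeas]
    refine MeasureTheory.setIntegral_congr_fun measurableSet_Ioi fun t ht => ?_
    simp only [id, NNReal.smul_def, Real.coe_toNNReal _ (Real.rpow_nonneg (le_of_lt ht) _),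
      Complex.real_smul]
    ring
  have hsub : Set.Iio (0 : ℝ) ⊆ interior (ProbabilityTheory.integrableExpSet id μ) := by
    refine interior_maximal (fun x hx => ?_) isOpen_Iio
    have hx' : 0 < -x := neg_pos.mpr hx
    rw [ProbabilityTheory.integrableExpSet, Set.mem_ofPred_eq, hμ,
      MeasureTheory.integrable_withDensity_iff_integrable_smul hmeas]
    have h := integrableOn_rpow_mul_exp_neg_mul_rpow (p := 1) (s := -s) (by linarith) one_pos hx'
    refine MeasureTheory.IntegrableOn.congr_fun h (fun t ht => ?_) measurableSet_Ioi
    simp only [id, NNReal.smul_def, Real.coe_toNNReal _ (Real.rpow_nonneg (le_of_lt ht) _),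
      smul_eq_mul, neg_neg, Real.rpow_one]
  rw [heq]
  refine ProbabilityTheory.differentiableOn_complexMGF.comp differentiableOn_id.neg fun r hr => ?_
  exact hsub (by simpa using hr)

lemma integral_cexp_mul_rpow {s : ℝ} (hs : s < 1) {r : ℂ} (hr : 0 < r.re) :
    ∫ t in Set.Ioi (0 : ℝ), Complex.exp (-r * (t : ℂ)) * ((t ^ (-s) : ℝ) : ℂ) =
      (1 / r) ^ ((1 - s : ℝ) : ℂ) * ((Real.Gamma (1 - s) : ℝ) : ℂ) := by
  have hopen : IsOpen {r : ℂ | 0 < r.re} := isOpen_lt continuous_const Complex.continuous_re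
  have hG : DifferentiableOn ℂ (fun r : ℂ => (1 / r) ^ ((1 - s : ℝ) : ℂ) *
      ((Real.Gamma (1 - s) : ℝ) : ℂ)) {r : ℂ | 0 < r.re} := by
    intro z hz
    have hz0 : z ≠ 0 := fun h => by simp [h] at hz
    refine (DifferentiableAt.mul_const (DifferentiableAt.cpow_const
      ((differentiableAt_const _).div differentiableAt_id hz0) ?_) _).differentiableWithinAt
    left
    rw [Pi.div_apply, id, one_div, Complex.inv_re]
    exact div_pos hz (Complex.normSq_pos.mpr hz0)
  have hreal : ∀ x : ℝ, 0 < x →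
      ∫ t in Set.Ioi (0 : ℝ), Complex.exp (-(x : ℂ) * (t : ℂ)) * ((t ^ (-s) : ℝ) : ℂ) =
        (1 / (x : ℂ)) ^ ((1 - s : ℝ) : ℂ) * ((Real.Gamma (1 - s) : ℝ) : ℂ) := fun x hx => by
    rw [← Complex.Gamma_ofReal, ← Complex.integral_cpow_mul_exp_neg_mul_Ioi
      (by rw [Complex.ofReal_re]; linarith) hx]
    refine MeasureTheory.setIntegral_congr_fun measurableSet_Ioi fun t ht => ?_
    rw [mul_comm, Complex.ofReal_cpow (le_of_lt ht)]
    push_cast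
    ring_nf
  refine ((differentiableOn_integral_cexp_mul_rpow hs).analyticOnNhd
    hopen).eqOn_of_preconnected_of_frequently_eq (hG.analyticOnNhd hopen)
    (convex_halfSpace_re_gt 0).isPreconnected (z₀ := 1) (by simp) ?_ hr
  have hofReal : Tendsto (fun x : ℝ => (x : ℂ)) (nhdsWithin 1 {1}ᶜ) (nhdsWithin 1 {1}ᶜ) := by
    refine tendsto_nhdsWithin_of_tendsto_nhds_of_eventually_within _ ?_ ?_
    · simpa using (Complex.continuous_ofReal.tendsto 1).mono_left nhdsWithin_le_nhds
    · filter_upwards [self_mem_nhdsWithin] with x hx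
      simpa using hx
  refine hofReal.frequently (Eventually.frequently ?_)
  filter_upwards [nhdsWithin_le_nhds (Ioi_mem_nhds one_pos)] with x hx
  exact hreal x hx

lemma one_div_neg_I_mul_cpow {ω : ℝ} (hω : 0 < ω) (s : ℝ) :
    (1 / (-(Complex.I * (ω : ℂ)))) ^ ((1 - s : ℝ) : ℂ) =
      Complex.I * Complex.exp (-Complex.I * (π : ℂ) * (s : ℂ) / 2) * ((ω ^ (s - 1) : ℝ) : ℂ) := by
  have hω' : (ω : ℂ) ≠ 0 := by exact_mod_cast hω.ne'
  have h : 1 / (-(Complex.I * (ω : ℂ))) = ((ω⁻¹ : ℝ) : ℂ) * Complex.I := by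
    push_cast
    field_simp
    simp
  have hI : Complex.exp ((π : ℂ) / 2 * Complex.I) = Complex.I := Complex.exp_pi_div_two_mul_I
  rw [h, Complex.cpow_def_of_ne_zero (by simp [hω']),
    Complex.log_ofReal_mul (inv_pos.mpr hω) Complex.I_ne_zero, Complex.log_I,
    Real.rpow_def_of_pos hω, Real.log_inv, Complex.ofReal_exp]
  nth_rewrite 2 [← hI]
  rw [← Complex.exp_add, ← Complex.exp_add]
  congr 1
  push_cast
  ring

lemma norm_integral_cexp_mul_rpow_sub_le {s : ℝ} (hs : 0 < s) (hs1 : s < 1) {r : ℂ}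
    (hr : 0 < r.re) {T : ℝ} (hT : 0 < T) :
    ‖(1 / r) ^ ((1 - s : ℝ) : ℂ) * ((Real.Gamma (1 - s) : ℝ) : ℂ) -
      ∫ t in (0 : ℝ)..T, Complex.exp (-r * (t : ℂ)) * ((t ^ (-s) : ℝ) : ℂ)‖ ≤
        2 * T ^ (-s) / ‖r‖ := by
  have hint := integrableOn_cexp_mul_rpow hs1 hr
  have hlim := MeasureTheory.intervalIntegral_tendsto_integral_Ioi 0 hint tendsto_id
  rw [integral_cexp_mul_rpow hs1 hr] at hlim
  have hii : ∀ B : ℝ, 0 < B → IntervalIntegrable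
      (fun t : ℝ => Complex.exp (-r * (t : ℂ)) * ((t ^ (-s) : ℝ) : ℂ)) MeasureTheory.volume 0 B :=
    fun B hB => (intervalIntegrable_iff_integrableOn_Ioc_of_le hB.le).mpr
      (hint.mono_set Set.Ioc_subset_Ioi_self)
  refine le_of_tendsto (hlim.sub_const _).norm ?_
  filter_upwards [eventually_ge_atTop T] with B hB
  rw [id, intervalIntegral.integral_interval_sub_left (hii B (hT.trans_le hB)) (hii T hT)]
  exact norm_integral_cexp_mul_rpow_le hs (fun h => by simp [h] at hr) hr.le hT hB

lemma tendsto_integral_cexp_mul_rpow {s ω : ℝ} (hs : 0 < s) (hs1 : s < 1) (hω : 0 < ω) :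
    Tendsto (fun T : ℝ => ∫ t in (0 : ℝ)..T,
        Complex.exp (Complex.I * (ω : ℂ) * (t : ℂ)) * ((t ^ (-s) : ℝ) : ℂ)) atTop
      (nhds ((1 / (-(Complex.I * (ω : ℂ)))) ^ ((1 - s : ℝ) : ℂ) *
        ((Real.Gamma (1 - s) : ℝ) : ℂ))) := by
  have hne : -(Complex.I * (ω : ℂ)) ≠ 0 := by simp [hω.ne']
  have hr : Tendsto (fun ε : ℝ => (ε : ℂ) - Complex.I * (ω : ℂ)) (nhdsWithin 0 (Set.Ioi 0))
      (nhds (-(Complex.I * (ω : ℂ)))) := by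
    have : Continuous (fun ε : ℝ => (ε : ℂ) - Complex.I * (ω : ℂ)) := by fun_prop
    simpa using (this.tendsto 0).mono_left nhdsWithin_le_nhds
  have hG : Tendsto (fun ε : ℝ => (1 / ((ε : ℂ) - Complex.I * (ω : ℂ))) ^ ((1 - s : ℝ) : ℂ) *
      ((Real.Gamma (1 - s) : ℝ) : ℂ)) (nhdsWithin 0 (Set.Ioi 0))
      (nhds ((1 / (-(Complex.I * (ω : ℂ)))) ^ ((1 - s : ℝ) : ℂ) *
        ((Real.Gamma (1 - s) : ℝ) : ℂ))) := by
    refine Tendsto.mul_const _ ((tendsto_const_nhds.div hr hne).cpow tendsto_const_nhds ?_)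
    rw [Complex.mem_slitPlane_iff]
    right
    simp [hω.ne']
  have hbound : ∀ T : ℝ, 0 < T →
      ‖(1 / (-(Complex.I * (ω : ℂ)))) ^ ((1 - s : ℝ) : ℂ) * ((Real.Gamma (1 - s) : ℝ) : ℂ) -
        ∫ t in (0 : ℝ)..T, Complex.exp (Complex.I * (ω : ℂ) * (t : ℂ)) * ((t ^ (-s) : ℝ) : ℂ)‖
        ≤ 2 * T ^ (-s) / ‖-(Complex.I * (ω : ℂ))‖ := fun T hT => by
    have hF : Tendsto (fun ε : ℝ => ∫ t in (0 : ℝ)..T,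
        Complex.exp (-((ε : ℂ) - Complex.I * (ω : ℂ)) * (t : ℂ)) * ((t ^ (-s) : ℝ) : ℂ))
        (nhdsWithin 0 (Set.Ioi 0)) (nhds (∫ t in (0 : ℝ)..T,
          Complex.exp (Complex.I * (ω : ℂ) * (t : ℂ)) * ((t ^ (-s) : ℝ) : ℂ))) := by
      refine intervalIntegral.tendsto_integral_filter_of_dominated_convergence
        (fun t : ℝ => t ^ (-s)) ?_ ?_ (intervalIntegral.intervalIntegrable_rpow' (by linarith)) ?_
      · refine Eventually.of_forall fun ε => Measurable.aestronglyMeasurable ?_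
        fun_prop
      · filter_upwards [self_mem_nhdsWithin] with ε hε
        refine MeasureTheory.ae_of_all _ fun t ht => ?_
        rw [Set.uIoc_of_le hT.le] at ht
        have hp : 0 ≤ t ^ (-s) := Real.rpow_nonneg ht.1.le _
        rw [norm_mul, Complex.norm_exp, Complex.norm_real, Real.norm_of_nonneg hp]
        refine mul_le_of_le_one_left hp (Real.exp_le_one_iff.mpr ?_)
        simpa using mul_nonneg (le_of_lt hε) ht.1.le
      · refine MeasureTheory.ae_of_all _ fun t _ => ?_
        simpa using ((hr.neg.mul_const (t : ℂ)).cexp).mul_const ((t ^ (-s) : ℝ) : ℂ)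
    refine le_of_tendsto_of_tendsto (hG.sub hF).norm (tendsto_const_nhds.div hr.norm
      (norm_ne_zero_iff.mpr hne)) ?_
    filter_upwards [self_mem_nhdsWithin] with ε hε
    exact norm_integral_cexp_mul_rpow_sub_le hs hs1 (by simpa using hε) hT
  rw [tendsto_iff_norm_sub_tendsto_zero]
  have hzero : Tendsto (fun T : ℝ => 2 * T ^ (-s) / ‖-(Complex.I * (ω : ℂ))‖) atTop (nhds 0) := by
    simpa using ((tendsto_rpow_neg_atTop hs).const_mul 2).div_const ‖-(Complex.I * (ω : ℂ))‖
  refine squeeze_zero' (Eventually.of_forall fun _ => norm_nonneg _) ?_ hzero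
  filter_upwards [eventually_gt_atTop 0] with T hT
  rw [norm_sub_rev]
  exact hbound T hT

/-- For `a > 0`, `ω̃ > 0` with `a²ω̃² < 1`, the improper complex integral
`L₀(ω̃) = ∫₀^∞ e^{iω̃λ} λ^{-a²ω̃²} dλ` (as the limit of `∫₀^T` as `T → ∞`) converges
and equals `i · e^{-iπa²ω̃²/2} · ω̃^{a²ω̃²−1} · Γ(1 − a²ω̃²)`. -/
theorem stmt_2 (a ω : ℝ) (ha : 0 < a) (hω : 0 < ω) (h1 : a ^ 2 * ω ^ 2 < 1) :
    Tendsto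
      (fun T : ℝ => ∫ l in (0 : ℝ)..T,
        Complex.exp (Complex.I * (ω : ℂ) * (l : ℂ)) * ((l ^ (-(a ^ 2 * ω ^ 2)) : ℝ) : ℂ))
      atTop
      (nhds (Complex.I * Complex.exp (-Complex.I * (π : ℂ) * ((a ^ 2 * ω ^ 2 : ℝ) : ℂ) / 2)
        * ((ω ^ (a ^ 2 * ω ^ 2 - 1) : ℝ) : ℂ) * ((Real.Gamma (1 - a ^ 2 * ω ^ 2) : ℝ) : ℂ))) := by
  rw [← one_div_neg_I_mul_cpow hω]
  exact tendsto_integral_cexp_mul_rpow (by positivity) h1 hω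
end

section
/- Let a > 0, P ≥ 0, M ≥ 0 be reals, let g∞ ∈ ℝ, and let g : (0,∞) → ℝ be differentiable. Assume: (i) g(λ) = O(|log λ|^P) as λ → 0⁺; (ii) g(λ) − g∞ = O((log λ)^M / λ) and g′(λ) = O((log λ)^M / λ²) as λ → ∞. Then for all sufficiently small ω̃ > 0 the improper integral L_g(ω̃) = ∫₀^∞ e^{i ω̃ λ} · λ^{-a² ω̃²} · g(λ) dλ (understood as lim_{T→∞} ∫₀^T) converges, and lim_{ω̃ → 0⁺} ω̃ · L_g(ω̃) = i · g∞; equivalently, L_g(ω̃) = i g∞ / ω̃ + o(1/ω̃) as ω̃ → 0⁺. -/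
open Real Filter Asymptotics
open Set MeasureTheory Topology

lemma norm_exp_I_mul_ofReal (ω l : ℝ) : ‖Complex.exp (Complex.I * ω * l)‖ = 1 := by
  rw [show Complex.I * ω * l = ((ω * l : ℝ) : ℂ) * Complex.I by push_cast; ring]
  exact Complex.norm_exp_ofReal_mul_I _

lemma integrableOn_exp_mul {A : ℝ} {f : ℝ → ℝ} (ω : ℝ) (hf : IntegrableOn f (Ioi A)) :
    IntegrableOn (fun l : ℝ => Complex.exp (Complex.I * ω * l) * (f l : ℂ)) (Ioi A) := by
  refine Integrable.bdd_mul (c := 1) hf.ofReal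
    (by fun_prop : Continuous fun l : ℝ => Complex.exp (Complex.I * ω * l)).aestronglyMeasurable ?_
  exact Eventually.of_forall fun l => (norm_exp_I_mul_ofReal ω l).le

/-- Integration by parts for an oscillatory integral over a half line. -/
lemma tendsto_integral_exp_mul_of_hasDerivAt {A ω : ℝ} (hω : 0 < ω) {f f' : ℝ → ℝ}
    (hf : ∀ l, A ≤ l → HasDerivAt f (f' l) l) (hf' : IntegrableOn f' (Ioi A))
    (hlim : Tendsto f atTop (𝓝 0)) :
    Tendsto (fun T : ℝ => ∫ l in A..T, Complex.exp (Complex.I * ω * l) * (f l : ℂ)) atTop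
      (𝓝 (Complex.I / ω * (Complex.exp (Complex.I * ω * A) * f A
        + ∫ l in Ioi A, Complex.exp (Complex.I * ω * l) * (f' l : ℂ)))) := by
  have hωC : (ω : ℂ) ≠ 0 := by exact_mod_cast hω.ne'
  have hexp : ∀ l : ℝ, HasDerivAt (fun l : ℝ => Complex.exp (Complex.I * ω * l))
      (Complex.exp (Complex.I * ω * l) * (Complex.I * ω)) l := fun l => by
    have h := ((Complex.ofRealCLM.hasDerivAt (x := l)).const_mul (Complex.I * (ω : ℂ))).cexp
    simpa using h
  have hparts : ∀ T, A ≤ T → ∫ l in A..T, Complex.exp (Complex.I * ω * l) * (f l : ℂ) =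
      Complex.I / ω * (Complex.exp (Complex.I * ω * A) * f A
        - Complex.exp (Complex.I * ω * T) * f T
        + ∫ l in A..T, Complex.exp (Complex.I * ω * l) * (f' l : ℂ)) := by
    intro T hT
    have h := intervalIntegral.integral_mul_deriv_eq_deriv_mul (a := A) (b := T)
      (u := fun l => (f l : ℂ)) (u' := fun l => (f' l : ℂ))
      (v := fun l : ℝ => Complex.exp (Complex.I * ω * l))
      (v' := fun l : ℝ => Complex.exp (Complex.I * ω * l) * (Complex.I * ω))
      (fun l hl => (hf l (by rw [uIcc_of_le hT] at hl; exact hl.1)).ofReal_comp)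
      (fun l _ => hexp l)
      (by
        rw [intervalIntegrable_iff_integrableOn_Ioc_of_le hT]
        exact (hf'.mono_set Ioc_subset_Ioi_self).ofReal)
      (by apply Continuous.intervalIntegrable; fun_prop)
    have e1 : ∫ l in A..T, (f l : ℂ) * (Complex.exp (Complex.I * ω * l) * (Complex.I * ω)) =
        (Complex.I * ω) * ∫ l in A..T, Complex.exp (Complex.I * ω * l) * (f l : ℂ) := by
      rw [← intervalIntegral.integral_const_mul]
      congr 1; ext l; ring
    have e2 : ∫ l in A..T, (f' l : ℂ) * Complex.exp (Complex.I * ω * l) =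
        ∫ l in A..T, Complex.exp (Complex.I * ω * l) * (f' l : ℂ) := by
      congr 1; ext l; ring
    rw [e1, e2] at h
    have h2 : Complex.I / ω * ((Complex.I * ω) *
        ∫ l in A..T, Complex.exp (Complex.I * ω * l) * (f l : ℂ)) =
        -∫ l in A..T, Complex.exp (Complex.I * ω * l) * (f l : ℂ) := by
      rw [← mul_assoc, show Complex.I / ω * (Complex.I * ω) = -1 by
        field_simp; exact Complex.I_sq]
      ring
    rw [h] at h2
    rw [← neg_neg (∫ l in A..T, Complex.exp (Complex.I * ω * l) * (f l : ℂ)), ← h2]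
    ring
  have hzero : Tendsto (fun T : ℝ => Complex.exp (Complex.I * ω * T) * f T) atTop (𝓝 0) := by
    rw [tendsto_zero_iff_norm_tendsto_zero]
    simpa [norm_exp_I_mul_ofReal] using hlim.norm
  have hI := intervalIntegral_tendsto_integral_Ioi A (integrableOn_exp_mul ω hf') tendsto_id
  have := ((tendsto_const_nhds (x := Complex.exp (Complex.I * ω * A) * f A)).sub hzero
    |>.add hI).const_mul (Complex.I / (ω : ℂ))
  rw [sub_zero] at this
  refine this.congr' ?_
  filter_upwards [eventually_ge_atTop A] with T hT
  exact (hparts T hT).symm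

/-- Polynomial-logarithmic bounds at infinity give power bounds on a half line. -/
lemma exists_bounds_atTop {M ginf : ℝ} {g : ℝ → ℝ}
    (hinf : (fun l : ℝ => g l - ginf) =O[atTop] fun l : ℝ => Real.log l ^ M / l)
    (hinf' : (fun l : ℝ => deriv g l) =O[atTop] fun l : ℝ => Real.log l ^ M / l ^ 2) :
    Tendsto g atTop (𝓝 ginf) ∧ ∃ A C : ℝ, 1 ≤ A ∧ 0 ≤ C ∧ ∀ l, A ≤ l →
      |g l| ≤ C ∧ |deriv g l| ≤ C * l ^ (-(3 / 2) : ℝ) := by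
  have hlog : (fun l : ℝ => Real.log l ^ M) =O[atTop] fun l : ℝ => l ^ (1 / 2 : ℝ) :=
    (isLittleO_log_rpow_rpow_atTop M (by norm_num)).isBigO
  have hg : Tendsto g atTop (𝓝 ginf) := by
    have h1 : (fun l : ℝ => Real.log l ^ M / l) =O[atTop] fun l : ℝ => l ^ (-(1 / 2) : ℝ) := by
      refine (hlog.mul (isBigO_refl (fun l : ℝ => l⁻¹) atTop)).trans_eventuallyEq ?_
      filter_upwards [eventually_gt_atTop 0] with l hl
      rw [← Real.rpow_neg_one, ← Real.rpow_add hl]; norm_num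
    have h2 := (hinf.trans h1).trans_tendsto (tendsto_rpow_neg_atTop (by norm_num))
    simpa using h2.add_const ginf
  have hd : (fun l : ℝ => deriv g l) =O[atTop] fun l : ℝ => l ^ (-(3 / 2) : ℝ) := by
    refine (hinf'.trans (hlog.mul (isBigO_refl (fun l : ℝ => (l ^ 2)⁻¹) atTop))).trans_eventuallyEq ?_
    filter_upwards [eventually_gt_atTop 0] with l hl
    rw [← Real.rpow_natCast, ← Real.rpow_neg hl.le, ← Real.rpow_add hl]; norm_num
  obtain ⟨C₁, hC₁⟩ := hd.bound
  have hb : ∀ᶠ l in atTop, |g l| ≤ |ginf| + 1 :=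
    (hg.abs.eventually (gt_mem_nhds (lt_add_one _))).mono fun _ h => h.le
  obtain ⟨B, hB⟩ := eventually_atTop.1 (hC₁.and hb)
  refine ⟨hg, max B 1, max C₁ (|ginf| + 1), le_max_right _ _,
    le_max_of_le_right (by positivity), fun l hl => ?_⟩
  have hl1 : 1 ≤ l := (le_max_right _ _).trans hl
  obtain ⟨h1, h2⟩ := hB l ((le_max_left _ _).trans hl)
  refine ⟨h2.trans (le_max_right _ _), ?_⟩
  have hp : 0 < l ^ (-(3 / 2) : ℝ) := Real.rpow_pos_of_pos (by linarith) _
  rw [Real.norm_eq_abs, Real.norm_eq_abs, abs_of_pos hp] at h1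
  exact h1.trans (mul_le_mul_of_nonneg_right (le_max_left _ _) hp.le)

/-- A logarithmic bound at the origin gives a power bound on `(0, A]`. -/
lemma exists_bound_Ioc {P A : ℝ} {g : ℝ → ℝ} (hg : ContinuousOn g (Ioi 0))
    (h0 : g =O[𝓝[>] 0] fun l : ℝ => |Real.log l| ^ P) :
    ∃ C : ℝ, ∀ l ∈ Ioc 0 A, |g l| ≤ C * l ^ (-(1 / 4) : ℝ) := by
  obtain ⟨C₁, hC₁⟩ := (h0.trans
    (isLittleO_abs_log_rpow_rpow_nhdsGT_zero P (s := -(1 / 4)) (by norm_num)).isBigO).bound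
  obtain ⟨δ, hδ, hδ'⟩ := mem_nhdsGT_iff_exists_Ioo_subset.1 hC₁
  have hδ0 : 0 < δ := hδ
  have hq : ContinuousOn (fun l : ℝ => g l / l ^ (-(1 / 4) : ℝ)) (Icc δ A) := by
    refine (hg.mono fun l hl => hδ0.trans_le hl.1).div ?_ ?_
    · exact continuousOn_id.rpow_const fun l hl => Or.inl (hδ0.trans_le hl.1).ne'
    · exact fun l hl => (Real.rpow_pos_of_pos (hδ0.trans_le hl.1) _).ne'
  obtain ⟨C₂, hC₂⟩ := isCompact_Icc.exists_bound_of_continuousOn hq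
  refine ⟨max C₁ C₂, fun l hl => ?_⟩
  have hp : 0 < l ^ (-(1 / 4) : ℝ) := Real.rpow_pos_of_pos hl.1 _
  rcases lt_or_ge l δ with h | h
  · have h1 : ‖g l‖ ≤ C₁ * ‖l ^ (-(1 / 4) : ℝ)‖ := hδ' ⟨hl.1, h⟩
    rw [Real.norm_eq_abs, Real.norm_eq_abs, abs_of_pos hp] at h1
    exact h1.trans (mul_le_mul_of_nonneg_right (le_max_left _ _) hp.le)
  · have h1 := hC₂ l ⟨h, hl.2⟩
    rw [Real.norm_eq_abs, abs_div, abs_of_pos hp, div_le_iff₀ hp] at h1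
    exact h1.trans (mul_le_mul_of_nonneg_right (le_max_right _ _) hp.le)

/-- Uniform bound for the contribution of `(0, A]` to the oscillatory integral. -/
lemma exists_norm_integral_le_of_rpow_bound {A C : ℝ} (hA : 0 < A) {g : ℝ → ℝ}
    (hg : ContinuousOn g (Ioi 0)) (hC : ∀ l ∈ Ioc 0 A, |g l| ≤ C * l ^ (-(1 / 4) : ℝ)) :
    ∃ K : ℝ, ∀ ω ε : ℝ, 0 ≤ ε → ε ≤ 1 / 4 →
      IntervalIntegrable (fun l : ℝ => Complex.exp (Complex.I * ω * l) * ((l ^ (-ε) * g l : ℝ) : ℂ))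
        volume 0 A ∧
      ‖∫ l in (0 : ℝ)..A, Complex.exp (Complex.I * ω * l) * ((l ^ (-ε) * g l : ℝ) : ℂ)‖ ≤ K := by
  have hb : IntervalIntegrable
      (fun l : ℝ => C * l ^ (-(1 / 4) : ℝ) + C * l ^ (-(1 / 2) : ℝ)) volume 0 A :=
    ((intervalIntegral.intervalIntegrable_rpow' (by norm_num)).const_mul C).add
      ((intervalIntegral.intervalIntegrable_rpow' (by norm_num)).const_mul C)
  refine ⟨∫ l in (0 : ℝ)..A, C * l ^ (-(1 / 4) : ℝ) + C * l ^ (-(1 / 2) : ℝ),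
    fun ω ε hε hε' => ?_⟩
  have hle : ∀ l ∈ Ioc 0 A,
      ‖Complex.exp (Complex.I * ω * l) * ((l ^ (-ε) * g l : ℝ) : ℂ)‖ ≤
        C * l ^ (-(1 / 4) : ℝ) + C * l ^ (-(1 / 2) : ℝ) := by
    intro l hl
    have hl0 : 0 < l := hl.1
    have hp : 0 < l ^ (-(1 / 4) : ℝ) := Real.rpow_pos_of_pos hl0 _
    have hpε : 0 < l ^ (-ε) := Real.rpow_pos_of_pos hl0 _
    have h1 : l ^ (-ε) ≤ 1 + l ^ (-(1 / 4) : ℝ) := by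
      rcases le_total l 1 with h | h
      · have := Real.rpow_le_rpow_of_exponent_ge hl0 h (show -(1 / 4) ≤ -ε by linarith)
        linarith
      · have := Real.rpow_le_one_of_one_le_of_nonpos h (show -ε ≤ 0 by linarith)
        linarith
    have h2 : l ^ (-(1 / 2) : ℝ) = l ^ (-(1 / 4) : ℝ) * l ^ (-(1 / 4) : ℝ) := by
      rw [← Real.rpow_add hl0]; norm_num
    rw [norm_mul, norm_exp_I_mul_ofReal, one_mul, Complex.norm_real, Real.norm_eq_abs, abs_mul,
      abs_of_pos hpε, h2]
    calc l ^ (-ε) * |g l| ≤ (1 + l ^ (-(1 / 4) : ℝ)) * (C * l ^ (-(1 / 4) : ℝ)) :=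
          mul_le_mul h1 (hC l hl) (abs_nonneg _) (by positivity)
      _ = _ := by ring
  constructor
  · rw [intervalIntegrable_iff_integrableOn_Ioc_of_le hA.le] at hb ⊢
    refine Integrable.mono' hb (ContinuousOn.aestronglyMeasurable ?_ measurableSet_Ioc) ?_
    · refine ContinuousOn.mul (by fun_prop) (Complex.continuous_ofReal.comp_continuousOn ?_)
      refine ContinuousOn.mul ?_ (hg.mono fun l hl => hl.1)
      exact continuousOn_id.rpow_const fun l hl => Or.inl hl.1.ne'
    · exact ae_restrict_of_forall_mem measurableSet_Ioc hle
  · exact intervalIntegral.norm_integral_le_of_norm_le hA.le (Eventually.of_forall hle) hb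

lemma hasDerivAt_rpow_mul {g : ℝ → ℝ} (hg : DifferentiableOn ℝ g (Ioi 0)) (s : ℝ) {l : ℝ}
    (hl : 0 < l) :
    HasDerivAt (fun l : ℝ => l ^ s * g l) (l ^ s * deriv g l + s * (l ^ (s - 1) * g l)) l := by
  exact ((Real.hasDerivAt_rpow_const (p := s) (Or.inl hl.ne')).mul
    (hg.differentiableAt (Ioi_mem_nhds hl)).hasDerivAt).congr_deriv (by ring)

section Tail

variable {A C : ℝ} {g : ℝ → ℝ}

lemma integrableOn_rpow_mul_deriv (hA : 1 ≤ A)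
    (hC : ∀ l, A ≤ l → |deriv g l| ≤ C * l ^ (-(3 / 2) : ℝ)) {s : ℝ} (hs : s ≤ 0) :
    IntegrableOn (fun l : ℝ => l ^ s * deriv g l) (Ioi A) := by
  refine Integrable.mono' ((integrableOn_Ioi_rpow_of_lt (a := -(3 / 2)) (by norm_num)
    (by linarith : 0 < A)).const_mul C) ?_ ?_
  · exact ((measurable_id.pow_const s).mul (measurable_deriv g)).aestronglyMeasurable
  · refine ae_restrict_of_forall_mem measurableSet_Ioi fun l hl => ?_
    have hl1 : 1 ≤ l := hA.trans (le_of_lt hl)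
    have hp : 0 < l ^ s := Real.rpow_pos_of_pos (by linarith) _
    rw [norm_mul, Real.norm_eq_abs, Real.norm_eq_abs, abs_of_pos hp]
    exact (mul_le_of_le_one_left (abs_nonneg _)
      (Real.rpow_le_one_of_one_le_of_nonpos hl1 hs)).trans (hC l (le_of_lt hl))

lemma integrableOn_rpow_mul (hA : 1 ≤ A) (hg : DifferentiableOn ℝ g (Ioi 0))
    (hC : ∀ l, A ≤ l → |g l| ≤ C) {s : ℝ} (hs : s < -1) :
    IntegrableOn (fun l : ℝ => l ^ s * g l) (Ioi A) := by
  refine Integrable.mono' ((integrableOn_Ioi_rpow_of_lt hs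
    (by linarith : 0 < A)).mul_const C) ?_ ?_
  · refine ContinuousOn.aestronglyMeasurable (fun l hl => ?_) measurableSet_Ioi
    have hl0 : 0 < l := by linarith [mem_Ioi.1 hl]
    exact (hasDerivAt_rpow_mul hg s hl0).continuousAt.continuousWithinAt
  · refine ae_restrict_of_forall_mem measurableSet_Ioi fun l hl => ?_
    have hp : 0 < l ^ s := Real.rpow_pos_of_pos (by linarith [mem_Ioi.1 hl]) _
    rw [norm_mul, Real.norm_eq_abs, Real.norm_eq_abs, abs_of_pos hp]
    exact mul_le_mul_of_nonneg_left (hC l (le_of_lt hl)) hp.le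

lemma tendsto_rpow_mul_atTop_zero {m s : ℝ} (hs : s < 0) (hg : Tendsto g atTop (𝓝 m)) :
    Tendsto (fun l : ℝ => l ^ s * g l) atTop (𝓝 0) := by
  have h := tendsto_rpow_neg_atTop (neg_pos.2 hs)
  rw [neg_neg] at h
  simpa using h.mul hg

/-- The tail of the oscillatory integral after one integration by parts. -/
lemma tendsto_integral_exp_mul_rpow_mul {m : ℝ} (hA : 1 ≤ A) (hg : DifferentiableOn ℝ g (Ioi 0))
    (hlim : Tendsto g atTop (𝓝 m)) (hC : ∀ l, A ≤ l → |g l| ≤ C)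
    (hC' : ∀ l, A ≤ l → |deriv g l| ≤ C * l ^ (-(3 / 2) : ℝ)) {ω ε : ℝ} (hω : 0 < ω)
    (hε : 0 < ε) :
    Tendsto (fun T : ℝ => ∫ l in A..T,
        Complex.exp (Complex.I * ω * l) * ((l ^ (-ε) * g l : ℝ) : ℂ)) atTop
      (𝓝 (Complex.I / ω * (Complex.exp (Complex.I * ω * A) * ((A ^ (-ε) * g A : ℝ) : ℂ)
        + ((∫ l in Ioi A, Complex.exp (Complex.I * ω * l) * ((l ^ (-ε) * deriv g l : ℝ) : ℂ))
          - ε * ∫ l in Ioi A,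
            Complex.exp (Complex.I * ω * l) * ((l ^ (-ε - 1) * g l : ℝ) : ℂ))))) := by
  have h1 := integrableOn_rpow_mul_deriv hA hC' (s := -ε) (by linarith)
  have h2 := integrableOn_rpow_mul hA hg hC (s := -ε - 1) (by linarith)
  convert tendsto_integral_exp_mul_of_hasDerivAt hω
    (fun l hl => hasDerivAt_rpow_mul hg (-ε) (by linarith)) (h1.add (h2.const_mul (-ε)))
    (tendsto_rpow_mul_atTop_zero (by linarith) hlim) using 5
  rw [← integral_const_mul, ← integral_sub (integrableOn_exp_mul ω h1)
    ((integrableOn_exp_mul ω h2).const_mul _)]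
  congr 1; ext l; push_cast; ring

/-- One more integration by parts bounds the remainder by a multiple of `1 / ω`. -/
lemma norm_integral_exp_mul_rpow_mul_le {m : ℝ} (hA : 1 ≤ A)
    (hg : DifferentiableOn ℝ g (Ioi 0))
    (hlim : Tendsto g atTop (𝓝 m)) (hC : ∀ l, A ≤ l → |g l| ≤ C)
    (hC' : ∀ l, A ≤ l → |deriv g l| ≤ C * l ^ (-(3 / 2) : ℝ)) {ω ε : ℝ} (hω : 0 < ω)
    (hε : 0 < ε) (hε' : ε ≤ 1) :
    ‖∫ l in Ioi A, Complex.exp (Complex.I * ω * l) * ((l ^ (-ε - 1) * g l : ℝ) : ℂ)‖ ≤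
      1 / ω * (C + ∫ l in Ioi A, 3 * C * l ^ (-(3 / 2) : ℝ)) := by
  have hA0 : 0 < A := by linarith
  have h0 := integrableOn_rpow_mul hA hg hC (s := -ε - 1) (by linarith)
  have h1 := integrableOn_rpow_mul_deriv hA hC' (s := -ε - 1) (by linarith)
  have h2 := integrableOn_rpow_mul hA hg hC (s := -ε - 1 - 1) (by linarith)
  have hlim' := tendsto_integral_exp_mul_of_hasDerivAt hω
    (fun l hl => hasDerivAt_rpow_mul hg (-ε - 1) (by linarith))
    (h1.add (h2.const_mul (-ε - 1))) (tendsto_rpow_mul_atTop_zero (by linarith) hlim)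
  rw [tendsto_nhds_unique
    (intervalIntegral_tendsto_integral_Ioi A (integrableOn_exp_mul ω h0) tendsto_id) hlim',
    norm_mul, norm_div, Complex.norm_I, Complex.norm_real, Real.norm_eq_abs, abs_of_pos hω]
  refine mul_le_mul_of_nonneg_left ((norm_add_le _ _).trans (add_le_add ?_ ?_)) (by positivity)
  · have hp : 0 < A ^ (-ε - 1) := Real.rpow_pos_of_pos hA0 _
    rw [norm_mul, norm_exp_I_mul_ofReal, one_mul, Complex.norm_real, Real.norm_eq_abs, abs_mul,
      abs_of_pos hp]
    exact (mul_le_of_le_one_left (abs_nonneg _)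
      (Real.rpow_le_one_of_one_le_of_nonpos hA (by linarith))).trans (hC A le_rfl)
  · refine norm_integral_le_of_norm_le ((integrableOn_Ioi_rpow_of_lt (a := -(3 / 2)) (by norm_num)
      hA0).const_mul (3 * C)) (ae_restrict_of_forall_mem measurableSet_Ioi fun l hl => ?_)
    have hl' : A ≤ l := le_of_lt hl
    have hl1 : 1 ≤ l := hA.trans hl'
    have hp : 0 < l ^ (-ε - 1) := Real.rpow_pos_of_pos (by linarith) _
    have hp' : 0 < l ^ (-ε - 1 - 1) := Real.rpow_pos_of_pos (by linarith) _
    rw [norm_mul, norm_exp_I_mul_ofReal, one_mul, Complex.norm_real]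
    have hC0 : 0 ≤ C := (abs_nonneg _).trans (hC l hl')
    have b1 : |l ^ (-ε - 1) * deriv g l| ≤ C * l ^ (-(3 / 2) : ℝ) := by
      rw [abs_mul, abs_of_pos hp]
      exact (mul_le_of_le_one_left (abs_nonneg _)
        (Real.rpow_le_one_of_one_le_of_nonpos hl1 (by linarith))).trans (hC' l hl')
    have b2 : |l ^ (-ε - 1 - 1) * g l| ≤ C * l ^ (-(3 / 2) : ℝ) := by
      rw [abs_mul, abs_of_pos hp', mul_comm]
      exact mul_le_mul (hC l hl')
        (Real.rpow_le_rpow_of_exponent_le hl1 (by linarith)) hp'.le hC0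
    have b3 : |(-ε - 1) * (l ^ (-ε - 1 - 1) * g l)| ≤ 2 * (C * l ^ (-(3 / 2) : ℝ)) := by
      rw [abs_mul]
      refine mul_le_mul ?_ b2 (abs_nonneg _) (by norm_num)
      rw [abs_le]; constructor <;> linarith
    refine (abs_add_le _ _).trans ?_
    linarith

/-- As the damping and the frequency vanish, the integral of the derivative becomes the total
increment of `g`. -/
lemma tendsto_integral_exp_mul_rpow_mul_deriv {m : ℝ} (hA : 1 ≤ A)
    (hg : DifferentiableOn ℝ g (Ioi 0)) (hlim : Tendsto g atTop (𝓝 m))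
    (hC' : ∀ l, A ≤ l → |deriv g l| ≤ C * l ^ (-(3 / 2) : ℝ)) (a : ℝ) :
    Tendsto (fun ω : ℝ => ∫ l in Ioi A, Complex.exp (Complex.I * ω * l)
        * ((l ^ (-(a ^ 2 * ω ^ 2)) * deriv g l : ℝ) : ℂ)) (𝓝[>] 0)
      (𝓝 ((m : ℂ) - g A)) := by
  have hint : IntegrableOn (deriv g) (Ioi A) := by
    simpa using integrableOn_rpow_mul_deriv hA hC' (s := 0) le_rfl
  have heq : ∫ l in Ioi A, ((deriv g l : ℝ) : ℂ) = (m : ℂ) - g A := by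
    rw [integral_complex_ofReal, integral_Ioi_of_hasDerivAt_of_tendsto' (fun l hl =>
      (hg.differentiableAt (Ioi_mem_nhds (by linarith [mem_Ici.1 hl]))).hasDerivAt) hint hlim]
    push_cast; rfl
  rw [← heq]
  refine tendsto_integral_filter_of_dominated_convergence (fun l => |deriv g l|) ?_ ?_ hint.abs ?_
  · exact Eventually.of_forall fun ω => (integrableOn_exp_mul ω
      (integrableOn_rpow_mul_deriv hA hC' (by nlinarith [sq_nonneg (a * ω)]))).aestronglyMeasurable
  · refine Eventually.of_forall fun ω => ae_restrict_of_forall_mem measurableSet_Ioi fun l hl => ?_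
    have hl1 : 1 ≤ l := hA.trans (le_of_lt hl)
    have hp : 0 < l ^ (-(a ^ 2 * ω ^ 2)) := Real.rpow_pos_of_pos (by linarith) _
    rw [norm_mul, norm_exp_I_mul_ofReal, one_mul, Complex.norm_real, Real.norm_eq_abs, abs_mul,
      abs_of_pos hp]
    exact mul_le_of_le_one_left (abs_nonneg _)
      (Real.rpow_le_one_of_one_le_of_nonpos hl1 (by nlinarith [sq_nonneg (a * ω)]))
  · refine ae_restrict_of_forall_mem measurableSet_Ioi fun l hl => ?_
    have hl0 : l ≠ 0 := by linarith [mem_Ioi.1 hl]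
    have hc : Continuous fun ω : ℝ => Complex.exp (Complex.I * ω * l)
        * ((l ^ (-(a ^ 2 * ω ^ 2)) * deriv g l : ℝ) : ℂ) := by
      have : Continuous fun ω : ℝ => l ^ (-(a ^ 2 * ω ^ 2)) :=
        continuous_const.rpow (by fun_prop) fun _ => Or.inl hl0
      fun_prop
    simpa using (hc.tendsto 0).mono_left nhdsWithin_le_nhds

end Tail

/-- Let `a > 0`, `P ≥ 0`, `M ≥ 0`, `ginf ∈ ℝ` and `g : (0,∞) → ℝ` differentiable
with `g(λ) = O(|log λ|^P)` as `λ → 0⁺`, `g(λ) − ginf = O((log λ)^M/λ)` and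
`g′(λ) = O((log λ)^M/λ²)` as `λ → ∞`. Then for all sufficiently small `ω̃ > 0` the improper
integral `L_g(ω̃) = ∫₀^∞ e^{iω̃λ} λ^{-a²ω̃²} g(λ) dλ` converges, and `ω̃·L_g(ω̃) → i·ginf`
as `ω̃ → 0⁺`. -/
theorem stmt_4 (a P M ginf : ℝ) (ha : 0 < a) (hP : 0 ≤ P) (hM : 0 ≤ M)
    (g : ℝ → ℝ) (hdiff : DifferentiableOn ℝ g (Set.Ioi 0))
    (h0 : g =O[nhdsWithin 0 (Set.Ioi 0)] fun l : ℝ => |Real.log l| ^ P)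
    (hinf : (fun l : ℝ => g l - ginf) =O[atTop] fun l : ℝ => Real.log l ^ M / l)
    (hinf' : (fun l : ℝ => deriv g l) =O[atTop] fun l : ℝ => Real.log l ^ M / l ^ 2) :
    ∃ Lg : ℝ → ℂ,
      (∀ᶠ ω : ℝ in nhdsWithin (0 : ℝ) (Set.Ioi 0),
        Tendsto (fun T : ℝ => ∫ l in (0 : ℝ)..T,
            Complex.exp (Complex.I * (ω : ℂ) * (l : ℂ))
              * ((l ^ (-(a ^ 2 * ω ^ 2)) : ℝ) : ℂ) * ((g l : ℝ) : ℂ))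
          atTop (nhds (Lg ω)))
      ∧ Tendsto (fun ω : ℝ => (ω : ℂ) * Lg ω) (nhdsWithin 0 (Set.Ioi 0))
          (nhds (Complex.I * (ginf : ℂ))) := by
  have hcont : ContinuousOn g (Ioi 0) := hdiff.continuousOn
  obtain ⟨hlim, A, C, hA, -, hAC⟩ := exists_bounds_atTop hinf hinf'
  have hC : ∀ l, A ≤ l → |g l| ≤ C := fun l hl => (hAC l hl).1
  have hC' : ∀ l, A ≤ l → |deriv g l| ≤ C * l ^ (-(3 / 2) : ℝ) := fun l hl => (hAC l hl).2
  have hA0 : 0 < A := by linarith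
  obtain ⟨C₀, hC₀⟩ := exists_bound_Ioc (A := A) hcont h0
  obtain ⟨K, hK⟩ := exists_norm_integral_le_of_rpow_bound hA0 hcont hC₀
  set head : ℝ → ℂ := fun ω => ∫ l in (0 : ℝ)..A, Complex.exp (Complex.I * ω * l)
    * ((l ^ (-(a ^ 2 * ω ^ 2)) * g l : ℝ) : ℂ) with hhead
  set dint : ℝ → ℂ := fun ω => ∫ l in Ioi A, Complex.exp (Complex.I * ω * l)
    * ((l ^ (-(a ^ 2 * ω ^ 2)) * deriv g l : ℝ) : ℂ)
  set rem : ℝ → ℂ := fun ω => ∫ l in Ioi A, Complex.exp (Complex.I * ω * l)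
    * ((l ^ (-(a ^ 2 * ω ^ 2) - 1) * g l : ℝ) : ℂ)
  set bdry : ℝ → ℂ := fun ω => Complex.exp (Complex.I * ω * A)
    * ((A ^ (-(a ^ 2 * ω ^ 2)) * g A : ℝ) : ℂ) with hbdry
  have hpos : ∀ᶠ ω : ℝ in 𝓝[>] 0, 0 < ω := self_mem_nhdsWithin
  have hsmall : ∀ᶠ ω : ℝ in 𝓝[>] 0, a ^ 2 * ω ^ 2 < 1 / 4 := by
    have : Tendsto (fun ω : ℝ => a ^ 2 * ω ^ 2) (𝓝[>] 0) (𝓝 0) := by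
      have hc : Continuous fun ω : ℝ => a ^ 2 * ω ^ 2 := by fun_prop
      simpa using (hc.tendsto 0).mono_left nhdsWithin_le_nhds
    exact this.eventually (gt_mem_nhds (by norm_num))
  refine ⟨fun ω => head ω + Complex.I / ω * (bdry ω + (dint ω - (a ^ 2 * ω ^ 2 : ℝ) * rem ω)),
    ?_, ?_⟩
  · filter_upwards [hpos, hsmall] with ω hω hs
    have hε : 0 < a ^ 2 * ω ^ 2 := by positivity
    refine ((tendsto_integral_exp_mul_rpow_mul hA hdiff hlim hC hC' hω hε).const_add
      (head ω)).congr' ?_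
    filter_upwards [eventually_ge_atTop A] with T hT
    have hInt : IntervalIntegrable (fun l : ℝ => Complex.exp (Complex.I * ω * l)
        * ((l ^ (-(a ^ 2 * ω ^ 2)) * g l : ℝ) : ℂ)) volume A T := by
      refine ContinuousOn.intervalIntegrable ?_
      rw [uIcc_of_le hT]
      refine ContinuousOn.mul (by fun_prop) (Complex.continuous_ofReal.comp_continuousOn ?_)
      exact fun l hl => (hasDerivAt_rpow_mul hdiff _
        (hA0.trans_le hl.1)).continuousAt.continuousWithinAt
    rw [hhead, intervalIntegral.integral_add_adjacent_intervals (hK ω _ hε.le hs.le).1 hInt]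
    congr 1; ext l; push_cast; ring
  · have hω0 : Tendsto (fun ω : ℝ => ω) (𝓝[>] 0) (𝓝 0) := tendsto_id.mono_left nhdsWithin_le_nhds
    have t1 : Tendsto (fun ω : ℝ => (ω : ℂ) * head ω) (𝓝[>] 0) (𝓝 0) := by
      refine squeeze_zero_norm' ?_ (by simpa using hω0.mul_const K)
      filter_upwards [hpos, hsmall] with ω hω hs
      rw [norm_mul, Complex.norm_real, Real.norm_eq_abs, abs_of_pos hω]
      exact mul_le_mul_of_nonneg_left (hK ω _ (by positivity) hs.le).2 hω.le
    have t2 : Tendsto bdry (𝓝[>] 0) (𝓝 (g A)) := by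
      have hc : Continuous bdry := by
        have : Continuous fun ω : ℝ => A ^ (-(a ^ 2 * ω ^ 2)) :=
          continuous_const.rpow (by fun_prop) fun _ => Or.inl hA0.ne'
        fun_prop
      simpa [hbdry] using (hc.tendsto 0).mono_left nhdsWithin_le_nhds
    have t3 : Tendsto dint (𝓝[>] 0) (𝓝 ((ginf : ℂ) - g A)) :=
      tendsto_integral_exp_mul_rpow_mul_deriv hA hdiff hlim hC' a
    have t4 : Tendsto (fun ω : ℝ => ((a ^ 2 * ω ^ 2 : ℝ) : ℂ) * rem ω) (𝓝[>] 0) (𝓝 0) := by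
      have hbound := hω0.mul_const (a ^ 2 * (C + ∫ l in Ioi A, 3 * C * l ^ (-(3 / 2) : ℝ)))
      rw [zero_mul] at hbound
      refine squeeze_zero_norm' ?_ hbound
      filter_upwards [hpos, hsmall] with ω hω hs
      have hε : 0 < a ^ 2 * ω ^ 2 := by positivity
      rw [norm_mul, Complex.norm_real, Real.norm_eq_abs, abs_of_pos hε]
      refine (mul_le_mul_of_nonneg_left (norm_integral_exp_mul_rpow_mul_le hA hdiff hlim hC hC' hω
        hε (by linarith)) hε.le).trans_eq ?_
      field_simp
    have t := t1.add ((t2.add (t3.sub t4)).const_mul Complex.I)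
    have hval : (0 : ℂ) + Complex.I * ((g A : ℂ) + ((ginf : ℂ) - g A - 0)) = Complex.I * ginf := by
      ring
    rw [hval] at t
    refine t.congr' ?_
    filter_upwards [hpos] with ω hω
    have : (ω : ℂ) ≠ 0 := by exact_mod_cast hω.ne'
    field_simp
end

section
/- Let δ : ℕ → ℝ be a sequence satisfying: (a) δ(ℓ) + 1/(2π²ℓ²) + (3/(2π⁴ℓ⁴))·(log(2πℓ) + γ − 11/6) = o(ℓ⁻⁴) as ℓ → ∞; (b) the Pandey sum rule δ(0) + 2·∑_{ℓ=1}^∞ δ(ℓ) = 0; (c) the sum rule ∑_{ℓ=1}^∞ ℓ·(δ(ℓ) + 1/(2π²ℓ²)) = 1/12 − log(2π)/(2π²). Define W(L) = L·δ(0) + 2·∑_{ℓ=1}^{L−1} (L − ℓ)·δ(ℓ). Then, as L → ∞ along positive integers, W(L) = (1/π²)·(log(2πL) + γ + 1) − 1/6 − (1/(2π⁴L²))·(log(2πL) + γ − (π² + 6)/6) + o(L⁻²). -/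
open Real Filter Asymptotics

open Topology

/-- A null sequence whose increments are negligible against those of an antitone null sequence `G`
is itself negligible against `G`. -/
lemma isLittleO_of_sub_isLittleO_sub {F G : ℕ → ℝ} (hF : Tendsto F atTop (𝓝 0))
    (hG : Tendsto G atTop (𝓝 0)) (hanti : ∀ᶠ n in atTop, G (n + 1) ≤ G n)
    (h : (fun n => F (n + 1) - F n) =o[atTop] fun n => G n - G (n + 1)) : F =o[atTop] G := by
  rw [isLittleO_iff]
  intro c hc
  obtain ⟨N, hN⟩ := eventually_atTop.1 ((isLittleO_iff.1 h hc).and hanti)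
  have key : ∀ n, N ≤ n → |F (n + 1) - F n| ≤ c * (G n - G (n + 1)) := fun n hn => by
    have h1 := (hN n hn).1
    rwa [Real.norm_eq_abs, Real.norm_eq_abs, abs_of_nonneg (sub_nonneg.2 (hN n hn).2)] at h1
  filter_upwards [eventually_ge_atTop N] with n hn
  have mono : ∀ k, |F (n + k) - F n| ≤ c * (G n - G (n + k)) := by
    intro k
    induction k with
    | zero => simp
    | succ k ih =>
      have h1 := key (n + k) (by omega)
      have h2 := abs_sub_le (F (n + k + 1)) (F (n + k)) (F n)
      rw [← add_assoc]
      linarith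
  have shift : Tendsto (fun k => n + k) atTop atTop :=
    tendsto_atTop_mono (fun k => Nat.le_add_left k n) tendsto_id
  have hlim := le_of_tendsto_of_tendsto' ((hF.comp shift).sub_const (F n)).abs
    (((hG.comp shift).const_sub (G n)).const_mul c) mono
  simp only [zero_sub, abs_neg, sub_zero] at hlim
  rw [Real.norm_eq_abs, Real.norm_eq_abs]
  exact hlim.trans (mul_le_mul_of_nonneg_left (le_abs_self _) hc.le)

/-- A null sequence with increments `o(n⁻⁽ᵏ⁺¹⁾)`, `k ≥ 1`, is `o(n⁻ᵏ)`. -/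
lemma isLittleO_inv_pow_of_sub {F : ℕ → ℝ} {k : ℕ} (hk : k ≠ 0) (hF : Tendsto F atTop (𝓝 0))
    (h : (fun n => F (n + 1) - F n) =o[atTop] fun n : ℕ => ((n : ℝ) ^ (k + 1))⁻¹) :
    F =o[atTop] fun n : ℕ => ((n : ℝ) ^ k)⁻¹ := by
  refine isLittleO_of_sub_isLittleO_sub hF ?_ ?_ (h.trans_isBigO ?_)
  · exact ((tendsto_pow_atTop hk).comp tendsto_natCast_atTop_atTop).inv_tendsto_atTop
  · filter_upwards [eventually_gt_atTop 0] with n hn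
    have : (0 : ℝ) < n := by exact_mod_cast hn
    push_cast
    gcongr
    linarith
  · refine IsBigO.of_bound (2 ^ k) ?_
    filter_upwards [eventually_ge_atTop 1] with n hn
    have hn1 : (1 : ℝ) ≤ n := by exact_mod_cast hn
    have hn0 : (0 : ℝ) < n := by linarith
    have hpow : (n : ℝ) ^ k * (n + 1) ≤ n * (n + 1) ^ k := by
      obtain ⟨j, rfl⟩ := Nat.exists_eq_succ_of_ne_zero hk
      have : (n : ℝ) ^ j ≤ (n + 1) ^ j := by gcongr; linarith
      calc (n : ℝ) ^ (j + 1) * (n + 1) = n * (n + 1) * n ^ j := by ring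
        _ ≤ n * (n + 1) * (n + 1) ^ j := by gcongr
        _ = n * (n + 1) ^ (j + 1) := by ring
    have h2 : ((n : ℝ) + 1) ^ k ≤ 2 ^ k * n ^ k := by
      rw [← mul_pow]; gcongr; linarith
    have hP : (0 : ℝ) < n ^ k := by positivity
    have hQ : (0 : ℝ) < (n + 1 : ℝ) ^ k := by positivity
    have hge : ((n : ℝ) ^ (k + 1))⁻¹ ≤ 2 ^ k * (((n : ℝ) ^ k)⁻¹ - ((n + 1 : ℝ) ^ k)⁻¹) := by
      have h3 : (n : ℝ) ^ k ≤ n * ((n + 1 : ℝ) ^ k - n ^ k) := by linarith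
      have h4 : (n + 1 : ℝ) ^ k * n ^ k ≤ 2 ^ k * n ^ k * (n * ((n + 1 : ℝ) ^ k - n ^ k)) :=
        mul_le_mul h2 h3 hP.le (by positivity)
      rw [inv_sub_inv hP.ne' hQ.ne', pow_succ, ← mul_div_assoc, inv_eq_one_div,
        div_le_div_iff₀ (by positivity) (by positivity)]
      linarith
    push_cast
    rw [Real.norm_eq_abs, abs_of_pos (by positivity)]
    exact hge.trans (mul_le_mul_of_nonneg_left (le_abs_self _) (by positivity))

lemma tendsto_log_one_sub_add_self_div_sq :
    Tendsto (fun u : ℝ => (log (1 - u) + u) / u ^ 2) (𝓝[≠] 0) (𝓝 (-1 / 2)) := by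
  have hb : Tendsto (fun u : ℝ => |u| / (1 - |u|)) (𝓝[≠] 0) (𝓝 0) := by
    have : ContinuousAt (fun u : ℝ => |u| / (1 - |u|)) 0 := by
      apply ContinuousAt.div <;> first | fun_prop | simp
    simpa using this.tendsto.mono_left nhdsWithin_le_nhds
  rw [tendsto_iff_norm_sub_tendsto_zero]
  refine squeeze_zero' (Eventually.of_forall fun _ => norm_nonneg _) ?_ hb
  have hlt : ∀ᶠ u : ℝ in 𝓝[≠] 0, |u| < 1 := by
    refine nhdsWithin_le_nhds ?_
    filter_upwards [Metric.ball_mem_nhds (0 : ℝ) one_pos] with u hu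
    simpa using hu
  filter_upwards [hlt, self_mem_nhdsWithin] with u hu hu0
  have hu0 : u ≠ 0 := hu0
  have h := Real.abs_log_sub_add_sum_range_le hu 2
  simp only [Finset.sum_range_succ, Finset.sum_range_zero] at h
  norm_num at h
  have e : (log (1 - u) + u) / u ^ 2 - -1 / 2 = (u + u ^ 2 / 2 + log (1 - u)) / u ^ 2 := by
    field_simp; ring
  rw [e, Real.norm_eq_abs, abs_div, abs_of_pos (by positivity : (0 : ℝ) < u ^ 2),
    div_le_iff₀ (by positivity)]
  refine h.trans (le_of_eq ?_)
  rw [pow_succ, sq_abs]; ring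

lemma tendsto_log_one_sub_div_self :
    Tendsto (fun u : ℝ => log (1 - u) / u) (𝓝[≠] 0) (𝓝 (-1)) := by
  have h := (tendsto_log_one_sub_add_self_div_sq.mul
    (tendsto_id.mono_left nhdsWithin_le_nhds : Tendsto (fun u : ℝ => u) (𝓝[≠] 0) (𝓝 0))).sub_const 1
  refine (h.congr' ?_).trans (by norm_num)
  filter_upwards [self_mem_nhdsWithin] with u hu
  have hu : u ≠ 0 := hu
  simp only [id]
  field_simp
  ring

lemma tendsto_inv_atTop_punctured_nhds_zero : Tendsto (fun x : ℝ => x⁻¹) atTop (𝓝[≠] 0) :=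
  tendsto_inv_atTop_nhdsGT_zero.mono_right (nhdsWithin_mono _ fun _ hx => ne_of_gt hx)

lemma log_add_one_eq {x : ℝ} (hx : 1 < x) : log (x + 1) = log x + log (1 - -x⁻¹) := by
  have h0 : 0 < x := by linarith
  rw [← Real.log_mul h0.ne' (by have := inv_pos.2 h0; linarith)]
  congr 1; field_simp; ring

lemma log_sub_one_eq {x : ℝ} (hx : 1 < x) : log (x - 1) = log x + log (1 - x⁻¹) := by
  have h0 : 0 < x := by linarith
  rw [← Real.log_mul h0.ne' (by have := inv_lt_one_of_one_lt₀ hx; linarith)]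
  congr 1; field_simp

lemma log_one_sub_inv_sq {x : ℝ} (hx : 1 < x) :
    log (1 - (x ^ 2)⁻¹) = log (1 - -x⁻¹) + log (1 - x⁻¹) := by
  have h0 : 0 < x := by linarith
  have h1 := inv_pos.2 h0
  have h2 := inv_lt_one_of_one_lt₀ hx
  rw [← Real.log_mul (by linarith) (by linarith)]
  congr 1; field_simp; ring

/-- Second-order expansion of the second central difference of `log`. -/
lemma tendsto_second_difference_log :
    Tendsto (fun x : ℝ => x ^ 4 * (log (x + 1) + log (x - 1) - 2 * log x) + x ^ 2) atTop
      (𝓝 (-1 / 2)) := by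
  have hu : Tendsto (fun x : ℝ => (x ^ 2)⁻¹) atTop (𝓝[≠] 0) :=
    tendsto_inv_atTop_punctured_nhds_zero.comp (tendsto_pow_atTop two_ne_zero)
  refine (tendsto_log_one_sub_add_self_div_sq.comp hu).congr' ?_
  filter_upwards [eventually_gt_atTop 1] with x hx
  have h0 : x ≠ 0 := by linarith
  simp only [Function.comp]
  rw [log_add_one_eq hx, log_sub_one_eq hx, log_one_sub_inv_sq hx]
  field_simp
  ring

/-- Expansion of the second central difference of `(log x + a) / x ^ 2`. -/
lemma tendsto_second_difference_log_div_sq (a : ℝ) :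
    Tendsto (fun x : ℝ => x ^ 4 * ((log (x + 1) + a) / (x + 1) ^ 2 + (log (x - 1) + a) / (x - 1) ^ 2
      - 2 * ((log x + a) / x ^ 2)) - 6 * (log x + a)) atTop (𝓝 (-5)) := by
  have hi : Tendsto (fun x : ℝ => x⁻¹) atTop (𝓝 0) := tendsto_inv_atTop_zero
  have hu : Tendsto (fun x : ℝ => (x ^ 2)⁻¹) atTop (𝓝[≠] 0) :=
    tendsto_inv_atTop_punctured_nhds_zero.comp (tendsto_pow_atTop two_ne_zero)
  have hneg : Tendsto (fun x : ℝ => -x⁻¹) atTop (𝓝[≠] 0) := by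
    refine tendsto_nhdsWithin_iff.2 ⟨by simpa using hi.neg, ?_⟩
    filter_upwards [eventually_gt_atTop 0] with x hx
    simpa using hx.ne'
  have l1 := tendsto_log_one_sub_div_self.comp hu
  have l2 := tendsto_log_one_sub_div_self.comp hneg
  have l3 := tendsto_log_one_sub_div_self.comp tendsto_inv_atTop_punctured_nhds_zero
  have hlog : Tendsto (fun x : ℝ => (log x + a) * (x⁻¹) ^ 2) atTop (𝓝 0) := by
    have h1 : Tendsto (fun x : ℝ => log x / x) atTop (𝓝 0) := by
      simpa using Real.tendsto_pow_log_div_mul_add_atTop 1 0 1 one_ne_zero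
    have h2 := (h1.mul hi).add ((hi.pow 2).const_mul a)
    refine (h2.congr fun x => ?_).trans (by simp)
    rw [div_eq_mul_inv]; ring
  have hden : Tendsto (fun x : ℝ => ((1 - (x⁻¹) ^ 2) ^ 2)⁻¹) atTop (𝓝 1) := by
    have := ((((hi.pow 2).const_sub 1)).pow 2).inv₀ (by norm_num)
    simpa using this
  have main := ((hlog.mul ((((hi.pow 2).const_mul 6).const_sub 10))).add
    ((((hi.pow 2).const_add 1).mul l1).add ((l2.add l3).const_mul 2))).mul hden
  refine (main.congr' ?_).trans (by norm_num)
  filter_upwards [eventually_gt_atTop 1] with x hx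
  have h0 : x ≠ 0 := by linarith
  have hp : x + 1 ≠ 0 := by linarith
  have hm : x - 1 ≠ 0 := by linarith
  have e : 1 - (x⁻¹) ^ 2 = (x + 1) * (x - 1) / x ^ 2 := by field_simp; ring
  simp only [Function.comp]
  rw [log_add_one_eq hx, log_sub_one_eq hx, log_one_sub_inv_sq hx, e]
  generalize log (1 - -x⁻¹) = A
  generalize log (1 - x⁻¹) = B
  generalize log x = C
  field_simp
  ring

/-- The asymptotic expression for the variance of the `x`-th ordered eigenvalue. -/
noncomputable def varianceExpansion (x : ℝ) : ℝ :=
  (1 / π ^ 2) * (Real.log (2 * π * x) + Real.eulerMascheroniConstant + 1) - 1 / 6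
    - (1 / (2 * π ^ 4 * x ^ 2))
      * (Real.log (2 * π * x) + Real.eulerMascheroniConstant - (π ^ 2 + 6) / 6)

lemma varianceExpansion_eq {x : ℝ} (hx : 0 < x) :
    varianceExpansion x = 1 / π ^ 2 * log x
      + (1 / π ^ 2 * (log (2 * π) + eulerMascheroniConstant + 1) - 1 / 6)
      - 1 / (2 * π ^ 4) *
        ((log x + (log (2 * π) + eulerMascheroniConstant - (π ^ 2 + 6) / 6)) / x ^ 2) := by
  have hpi := pi_pos
  rw [varianceExpansion, Real.log_mul (by positivity) hx.ne']
  field_simp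
  ring

lemma tendsto_log_add_const_div_self (a : ℝ) :
    Tendsto (fun x : ℝ => (log x + a) / x) atTop (𝓝 0) := by
  have h1 : Tendsto (fun x : ℝ => log x / x) atTop (𝓝 0) := by
    simpa using Real.tendsto_pow_log_div_mul_add_atTop 1 0 1 one_ne_zero
  simpa [add_mul, div_eq_mul_inv] using h1.add (tendsto_inv_atTop_zero.const_mul a)

lemma tendsto_varianceExpansion_sub_log :
    Tendsto (fun x => varianceExpansion x - 1 / π ^ 2 * log x) atTop
      (𝓝 (1 / π ^ 2 * (log (2 * π) + eulerMascheroniConstant + 1) - 1 / 6)) := by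
  set a := log (2 * π) + eulerMascheroniConstant - (π ^ 2 + 6) / 6 with ha
  have h := (((tendsto_log_add_const_div_self a).mul tendsto_inv_atTop_zero).const_mul
    (1 / (2 * π ^ 4))).const_sub (1 / π ^ 2 * (log (2 * π) + eulerMascheroniConstant + 1) - 1 / 6)
  refine (h.congr' ?_).trans (by simp)
  filter_upwards [eventually_gt_atTop 0] with x hx
  rw [varianceExpansion_eq hx, ← ha]
  generalize log x + a = A
  field_simp
  ring

lemma tendsto_mul_varianceExpansion_sub :
    Tendsto (fun x => x * (varianceExpansion (x + 1) - varianceExpansion x)) atTop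
      (𝓝 (1 / π ^ 2)) := by
  set a := log (2 * π) + eulerMascheroniConstant - (π ^ 2 + 6) / 6 with ha
  have hs : Tendsto (fun x : ℝ => x + 1) atTop atTop := tendsto_atTop_add_const_right _ _ tendsto_id
  have h1 := tendsto_log_add_const_div_self a
  have hr : Tendsto (fun x : ℝ => 1 - (x + 1)⁻¹) atTop (𝓝 1) := by
    simpa using (tendsto_inv_atTop_zero.comp hs).const_sub 1
  have h := ((Real.tendsto_mul_log_one_add_div_atTop 1).const_mul (1 / π ^ 2)).sub
    ((((h1.comp hs).mul hr).sub h1).const_mul (1 / (2 * π ^ 4)))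
  refine (h.congr' ?_).trans (by simp)
  filter_upwards [eventually_gt_atTop 1] with x hx
  have h0 : 0 < x := by linarith
  have hp : 0 < x + 1 := by linarith
  rw [varianceExpansion_eq h0, varianceExpansion_eq hp, ← ha, log_add_one_eq hx]
  simp only [Function.comp]
  rw [log_add_one_eq hx, one_div x, sub_neg_eq_add]
  generalize log (1 + x⁻¹) = A
  field_simp
  ring

lemma tendsto_second_difference_varianceExpansion :
    Tendsto (fun x => x ^ 4 * (varianceExpansion (x + 1) + varianceExpansion (x - 1)
      - 2 * varianceExpansion x) + x ^ 2 / π ^ 2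
      + 3 / π ^ 4 * (log (2 * π * x) + eulerMascheroniConstant - 11 / 6)) atTop (𝓝 0) := by
  have hpi := pi_pos
  set a := log (2 * π) + eulerMascheroniConstant - (π ^ 2 + 6) / 6 with ha
  have h := ((tendsto_second_difference_log.const_mul (1 / π ^ 2)).sub
    ((tendsto_second_difference_log_div_sq a).const_mul (1 / (2 * π ^ 4)))).add_const
      (3 / π ^ 4 * (π ^ 2 / 6 - 5 / 6))
  refine (h.congr' ?_).trans (le_of_eq ?_)
  · filter_upwards [eventually_gt_atTop 1] with x hx
    have h0 : 0 < x := by linarith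
    have hp : 0 < x + 1 := by linarith
    have hm : 0 < x - 1 := by linarith
    rw [varianceExpansion_eq h0, varianceExpansion_eq hp, varianceExpansion_eq hm, ← ha,
      Real.log_mul (by positivity) h0.ne']
    generalize (log (x + 1) + a) / (x + 1) ^ 2 = A
    generalize (log (x - 1) + a) / (x - 1) ^ 2 = B
    generalize (log x + a) / x ^ 2 = C
    rw [ha]
    field_simp
    ring
  · congr 1
    field_simp
    ring

/-- Let `δ : ℕ → ℝ` satisfy (a) the large-`ℓ` asymptotics
`δ(ℓ) + 1/(2π²ℓ²) + (3/(2π⁴ℓ⁴))(log(2πℓ) + γ − 11/6) = o(ℓ⁻⁴)`, (b) Pandey's sum rule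
`δ(0) + 2∑_{ℓ≥1} δ(ℓ) = 0`, and (c) `∑_{ℓ≥1} ℓ(δ(ℓ) + 1/(2π²ℓ²)) = 1/12 − log(2π)/(2π²)`.
With `W(L) = L·δ(0) + 2∑_{ℓ=1}^{L−1} (L − ℓ)δ(ℓ)`, one has, as `L → ∞` along positive
integers, `W(L) = (1/π²)(log(2πL) + γ + 1) − 1/6 − (1/(2π⁴L²))(log(2πL) + γ − (π²+6)/6)
 + o(L⁻²)`. -/
theorem stmt_17 (δ : ℕ → ℝ)
    (hasymp : (fun ℓ : ℕ =>
        δ ℓ + 1 / (2 * π ^ 2 * (ℓ : ℝ) ^ 2)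
          + (3 / (2 * π ^ 4 * (ℓ : ℝ) ^ 4))
            * (Real.log (2 * π * ℓ) + Real.eulerMascheroniConstant - 11 / 6))
      =o[atTop] fun ℓ : ℕ => ((ℓ : ℝ) ^ 4)⁻¹)
    (hsummable : Summable fun ℓ : ℕ => δ (ℓ + 1))
    (hPandey : δ 0 + 2 * ∑' ℓ : ℕ, δ (ℓ + 1) = 0)
    (hsummable' : Summable fun ℓ : ℕ =>
      ((ℓ : ℝ) + 1) * (δ (ℓ + 1) + 1 / (2 * π ^ 2 * ((ℓ : ℝ) + 1) ^ 2)))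
    (hrule : (∑' ℓ : ℕ, ((ℓ : ℝ) + 1) * (δ (ℓ + 1) + 1 / (2 * π ^ 2 * ((ℓ : ℝ) + 1) ^ 2)))
      = 1 / 12 - Real.log (2 * π) / (2 * π ^ 2)) :
    (fun L : ℕ =>
        ((L : ℝ) * δ 0 + 2 * ∑ ℓ ∈ Finset.Ico 1 L, ((L : ℝ) - (ℓ : ℝ)) * δ ℓ)
          - ((1 / π ^ 2) * (Real.log (2 * π * L) + Real.eulerMascheroniConstant + 1) - 1 / 6
            - (1 / (2 * π ^ 4 * (L : ℝ) ^ 2))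
              * (Real.log (2 * π * L) + Real.eulerMascheroniConstant - (π ^ 2 + 6) / 6)))
      =o[atTop] fun L : ℕ => ((L : ℝ) ^ 2)⁻¹ := by
  set W : ℕ → ℝ := fun L =>
    (L : ℝ) * δ 0 + 2 * ∑ ℓ ∈ Finset.Ico 1 L, ((L : ℝ) - (ℓ : ℝ)) * δ ℓ with hW
  have hWsub : ∀ n, W (n + 1) - W n = δ 0 + 2 * ∑ i ∈ Finset.range n, δ (i + 1) := fun n => by
    simp only [hW, Finset.sum_Ico_eq_sum_range, add_tsub_cancel_right]
    have e : ∑ k ∈ Finset.range (n - 1), ((n : ℝ) - ((1 + k : ℕ) : ℝ)) * δ (1 + k)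
        = ∑ k ∈ Finset.range n, ((n : ℝ) - ((1 + k : ℕ) : ℝ)) * δ (1 + k) := by
      rcases n with _ | m
      · simp
      · rw [Finset.sum_range_succ, add_tsub_cancel_right]
        push_cast
        ring
    have e2 : ∑ k ∈ Finset.range n, (((n + 1 : ℕ) : ℝ) - ((1 + k : ℕ) : ℝ)) * δ (1 + k)
        = ∑ k ∈ Finset.range n, ((n : ℝ) - ((1 + k : ℕ) : ℝ)) * δ (1 + k)
          + ∑ i ∈ Finset.range n, δ (i + 1) := by
      rw [← Finset.sum_add_distrib]
      refine Finset.sum_congr rfl fun k _ => ?_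
      rw [add_comm k 1]
      push_cast
      ring
    rw [e, e2]
    push_cast
    ring
  have hWeq : ∀ n : ℕ, W n = n * (W (n + 1) - W n)
      - 2 * ∑ i ∈ Finset.range n, ((i : ℝ) + 1) * (δ (i + 1) + 1 / (2 * π ^ 2 * ((i : ℝ) + 1) ^ 2))
      + 1 / π ^ 2 * (harmonic n : ℝ) := fun n => by
    induction n with
    | zero => simp [hW]
    | succ n ih =>
      have h1 := hWsub n
      have h2 := hWsub (n + 1)
      rw [Finset.sum_range_succ] at h2 ⊢
      rw [harmonic_succ]
      have h0 : (n : ℝ) + 1 ≠ 0 := by positivity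
      have e : 2 * (((n : ℝ) + 1) * (δ (n + 1) + 1 / (2 * π ^ 2 * ((n : ℝ) + 1) ^ 2)))
          = 2 * ((n : ℝ) + 1) * δ (n + 1) + 1 / π ^ 2 * ((n : ℝ) + 1)⁻¹ := by
        field_simp
      push_cast
      have h3 : W (n + 1 + 1) - W (n + 1) = W (n + 1) - W n + 2 * δ (n + 1) := by
        rw [h1, h2]; ring
      rw [h3]
      linear_combination ih + e
  set E : ℕ → ℝ := fun n => W n - varianceExpansion n with hE
  set D : ℕ → ℝ := fun n => E (n + 1) - E n with hD
  have hTn : Tendsto (fun n : ℕ => (n : ℝ) * (varianceExpansion (n + 1) - varianceExpansion n))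
      atTop (𝓝 (1 / π ^ 2)) := tendsto_mul_varianceExpansion_sub.comp tendsto_natCast_atTop_atTop
  have hDeq : ∀ n : ℕ, D n = δ 0 + 2 * ∑ i ∈ Finset.range n, δ (i + 1)
      - (varianceExpansion (n + 1) - varianceExpansion n) := fun n => by
    rw [← hWsub]
    simp only [hD, hE]
    push_cast
    ring
  have hD0 : Tendsto D atTop (𝓝 0) := by
    have h1 := (hsummable.hasSum.tendsto_sum_nat.const_mul 2).const_add (δ 0)
    rw [hPandey] at h1
    have h2 := hTn.mul tendsto_inv_atTop_nhds_zero_nat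
    refine ((h1.sub h2).congr' ?_).trans (by simp)
    filter_upwards [eventually_gt_atTop 0] with n hn
    have : (n : ℝ) ≠ 0 := by positivity
    rw [hDeq]
    field_simp
  have hS : (fun L : ℕ => 2 * δ L - (varianceExpansion (L + 1) + varianceExpansion (L - 1)
      - 2 * varianceExpansion L)) =o[atTop] fun L : ℕ => ((L : ℝ) ^ 4)⁻¹ := by
    have h1 := ((isLittleO_one_iff ℝ).2 (tendsto_second_difference_varianceExpansion.comp
      tendsto_natCast_atTop_atTop)).mul_isBigO (isBigO_refl (fun L : ℕ => ((L : ℝ) ^ 4)⁻¹) atTop)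
    simp only [one_mul] at h1
    refine ((hasymp.const_mul_left 2).sub h1).congr' ?_ EventuallyEq.rfl
    filter_upwards [eventually_gt_atTop 0] with n hn
    have : (n : ℝ) ≠ 0 := by positivity
    simp only [Function.comp]
    generalize log (2 * π * n) = A
    field_simp
    ring
  have hDsub : (fun n => D (n + 1) - D n) =o[atTop] fun n : ℕ => ((n : ℝ) ^ (3 + 1))⁻¹ := by
    refine ((hS.comp_tendsto (tendsto_add_atTop_nat 1)).trans_isBigO ?_).congr_left fun n => ?_
    · refine IsBigO.of_bound 1 ?_
      filter_upwards [eventually_gt_atTop 0] with n hn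
      have : (0 : ℝ) < n := by positivity
      simp only [Function.comp]
      rw [Real.norm_of_nonneg (by positivity), Real.norm_of_nonneg (by positivity), one_mul]
      push_cast
      gcongr
      linarith
    · simp only [Function.comp]
      rw [hDeq, hDeq, Finset.sum_range_succ]
      push_cast
      rw [add_sub_cancel_right]
      ring
  have hD3 := isLittleO_inv_pow_of_sub three_ne_zero hD0 hDsub
  have hnD : Tendsto (fun n : ℕ => (n : ℝ) * D n) atTop (𝓝 0) := by
    have h1 := (isBigO_refl (fun n : ℕ => (n : ℝ)) atTop).mul_isLittleO hD3
    refine h1.isBigO.trans_tendsto ?_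
    refine ((tendsto_inv_atTop_nhds_zero_nat (𝕜 := ℝ)).pow 2).congr' ?_ |>.trans (by simp)
    filter_upwards [eventually_gt_atTop 0] with n hn
    have : (n : ℝ) ≠ 0 := by positivity
    field_simp
  have hE0 : Tendsto E atTop (𝓝 0) := by
    have h1 := hsummable'.hasSum.tendsto_sum_nat
    rw [hrule] at h1
    have h2 := tendsto_varianceExpansion_sub_log.comp tendsto_natCast_atTop_atTop
    have h3 := ((((hnD.add hTn).sub (h1.const_mul 2)).add
      (Real.tendsto_harmonic_sub_log.const_mul (1 / π ^ 2))).sub h2)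
    refine (h3.congr fun n => ?_).trans (le_of_eq ?_)
    · have h4 := hWeq n
      simp only [Function.comp, hE, hD]
      push_cast
      linear_combination -h4
    · congr 1
      field_simp
      ring
  exact isLittleO_inv_pow_of_sub two_ne_zero hE0 hD3
end
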